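/- Assume A and A₀ satisfy part (i) of Hypothesis (H), and suppose that for some t₁ ≥ t₀ one has dom((A₀+t₁I)^{1/2}) ⊆ dom((A+t₁I)^{1/2}) and dom((A₀*+t₁I)^{1/2}) ⊆ dom((A*+t₁I)^{1/2}). Then for every z ∈ ℂ \ closure(−t₀ + S_{ω₀}), dom((A₀ − zI)^{1/2}) ⊆ dom((A − zI)^{1/2}) and dom((A₀* − zI)^{1/2}) ⊆ dom((A* − zI)^{1/2}). Moreover, (A − zI)^{1/2}(A₀ − zI)^{-1/2} and (A* − zI)^{1/2}(A₀* − zI)^{-1/2} are bounded operators on H and are analytic in z on ℂ \ closure(−t₀ + S_{ω₀}) with respect to the operator norm. -/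

import Mathlib

open MeasureTheory Filter
open scoped InnerProductSpace

noncomputable section
open scoped Classical


variable {H : Type*} [NormedAddCommGroup H] [InnerProductSpace ℂ H] [CompleteSpace H]

/-- `T` is the (bounded, everywhere defined) inverse of `A - z·I`. -/
def IsResolvent (A : H →ₗ.[ℂ] H) (z : ℂ) (T : H →L[ℂ] H) : Prop :=
  (∀ x : H, ∃ hx : T x ∈ A.domain, A ⟨T x, hx⟩ - z • T x = x) ∧
  ∀ u : A.domain, T (A u - z • (u : H)) = (u : H)

/-- The resolvent set of an unbounded operator. -/
def resolventSetP (A : H →ₗ.[ℂ] H) : Set ℂ := {z | ∃ T, IsResolvent A z T}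

/-- The spectrum of an unbounded operator. -/
def specP (A : H →ₗ.[ℂ] H) : Set ℂ := (resolventSetP A)ᶜ

/-- The resolvent `(A - z·I)⁻¹` (junk value `0` off the resolvent set). -/
def res (A : H →ₗ.[ℂ] H) (z : ℂ) : H →L[ℂ] H :=
  if h : ∃ T, IsResolvent A z T then h.choose else 0

/-- The operator `A + t·I` (same domain). -/
def shiftP (A : H →ₗ.[ℂ] H) (t : ℂ) : H →ₗ.[ℂ] H :=
  ⟨A.domain, A.toFun + t • A.domain.subtype⟩

/-- `A` is of positive type: `(-∞,0] ⊆ ρ(A)` and `sup_{t ≥ 0} ‖(1+t)(A+t)⁻¹‖ < ∞`. -/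
def IsPositiveTypeP (A : H →ₗ.[ℂ] H) : Prop :=
  (∀ x : ℝ, x ≤ 0 → (x : ℂ) ∈ resolventSetP A) ∧
  ∃ M : ℝ, ∀ t : ℝ, 0 ≤ t → (1 + t) * ‖res A (-(t : ℂ))‖ ≤ M

/-- The open sector of half-opening angle `ω` about the positive reals
(`(0,∞)` for `ω = 0`). -/
def sectorS (ω : ℝ) : Set ℂ :=
  if ω = 0 then (fun x : ℝ => (x : ℂ)) '' Set.Ioi 0
  else {z : ℂ | z ≠ 0 ∧ |Complex.arg z| < ω}

/-- `A` is sectorial of angle `ω`. -/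
def IsSectorialP (A : H →ₗ.[ℂ] H) (ω : ℝ) : Prop :=
  specP A ⊆ closure (sectorS ω) ∧
  ∀ ω' : ℝ, ω < ω' → ω' < Real.pi →
    ∃ M : ℝ, ∀ z ∈ (closure (sectorS ω'))ᶜ, ‖z‖ * ‖res A z‖ ≤ M

/-- The shifted sector `-t₀ + S_ω`. -/
def shiftedSector (t0 ω : ℝ) : Set ℂ := (fun w => -(t0 : ℂ) + w) '' sectorS ω

/-- The region `ℂ \ closure (-t₀ + S_ω)`. -/
def offSector (t0 ω : ℝ) : Set ℂ := (closure (shiftedSector t0 ω))ᶜ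

/-- The bounded operator `(A - z·I)^{-1/2}`, defined by the Balakrishnan-type formula
`(1/π) ∫₀^∞ t^{-1/2} (A + (t - z)·I)⁻¹ dt`. -/
def negSqrt (A : H →ₗ.[ℂ] H) (z : ℂ) : H →L[ℂ] H :=
  ((Real.pi : ℂ))⁻¹ • ∫ t in Set.Ioi (0 : ℝ), ((Real.sqrt t : ℂ))⁻¹ • res A (z - t)

/-- Trace-class (nuclear) bounded operators, characterized by
`sup { ∑ |⟨eᵢ, T fᵢ⟩| : (eᵢ), (fᵢ) finite orthonormal families } < ∞`. -/
def IsTraceClass (T : H →L[ℂ] H) : Prop :=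
  ∃ C : ℝ, ∀ (n : ℕ) (e f : Fin n → H), Orthonormal ℂ e → Orthonormal ℂ f →
    ∑ i, ‖⟪e i, T (f i)⟫_ℂ‖ ≤ C

/-- The trace norm `‖T‖₁`. -/
def traceNorm (T : H →L[ℂ] H) : ℝ :=
  sSup {s : ℝ | ∃ (n : ℕ) (e f : Fin n → H), Orthonormal ℂ e ∧ Orthonormal ℂ f ∧
    s = ∑ i, ‖⟪e i, T (f i)⟫_ℂ‖}

/-- The trace of a (trace-class) operator, computed in the Hilbert basis `b`. -/
def traceH (b : HilbertBasis ℕ ℂ H) (T : H →L[ℂ] H) : ℂ :=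
  ∑' n, ⟪(b n : H), T (b n)⟫_ℂ

/-- The Fredholm determinant `det (I + T)` (for `T` trace class), computed as the limit of
finite-section determinants along the Hilbert basis `b`. -/
def detI (b : HilbertBasis ℕ ℂ H) (T : H →L[ℂ] H) : ℂ :=
  limUnder atTop fun F : Finset ℕ =>
    Matrix.det (Matrix.of fun i j : F =>
      (if (i : ℕ) = (j : ℕ) then (1 : ℂ) else 0) + ⟪(b (i : ℕ) : H), T (b (j : ℕ))⟫_ℂ)

section ResolventFamily

open Set Topology

variable {𝓐 : Type*} [NormedRing 𝓐] [NormedAlgebra ℂ 𝓐]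

/-- A family of elements of a Banach algebra satisfying the first resolvent identity on `G`,
consisting of left-regular elements, with `G` stable under translation to the left and
`(1 + t) * ‖R (w - t)‖` locally uniformly bounded on `G`. -/
structure IsResolventFamily (R : ℂ → 𝓐) (G : Set ℂ) : Prop where
  eventually_bound : ∀ z ∈ G, ∃ C : ℝ, ∀ᶠ w in 𝓝 z,
    w ∈ G ∧ ∀ t : ℝ, 0 ≤ t → (1 + t) * ‖R (w - t)‖ ≤ C
  sub_mem : ∀ z ∈ G, ∀ t : ℝ, 0 ≤ t → z - t ∈ G
  sub_eq : ∀ z ∈ G, ∀ w ∈ G, R z - R w = (z - w) • (R z * R w)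
  regular : ∀ z ∈ G, ∀ x, R z * x = 0 → x = 0

/-- The Balakrishnan integral `π⁻¹ ∫₀^∞ t^{-1/2} R (z - t) dt`. -/
def sqrtIntegral (R : ℂ → 𝓐) (z : ℂ) : 𝓐 :=
  (Real.pi : ℂ)⁻¹ • ∫ t in Ioi (0 : ℝ), ((Real.sqrt t : ℂ))⁻¹ • R (z - t)

/-- The integral `π⁻¹ ∫₀^∞ t^{1/2} (R (w - t) - R (z - t)) dt`, which represents the difference
of the square roots of the inverses of `R z` and `R w`. -/
def sqrtDiff (R : ℂ → 𝓐) (w z : ℂ) : 𝓐 :=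
  (Real.pi : ℂ)⁻¹ • ∫ t in Ioi (0 : ℝ), (Real.sqrt t : ℂ) • (R (w - t) - R (z - t))

theorem integral_inv_sqrt_mul_inv_sq_add {q : ℝ} (hq : 0 < q) :
    IntegrableOn (fun t : ℝ => (√t)⁻¹ * (q ^ 2 + t)⁻¹) (Ioi 0) ∧
      ∫ t in Ioi (0 : ℝ), (√t)⁻¹ * (q ^ 2 + t)⁻¹ = Real.pi / q := by
  have hcont : ContinuousWithinAt (fun t : ℝ => 2 / q * Real.arctan (√t / q)) (Ici 0) 0 := by
    fun_prop
  have hderiv : ∀ t ∈ Ioi (0 : ℝ), HasDerivAt (fun t : ℝ => 2 / q * Real.arctan (√t / q))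
      ((√t)⁻¹ * (q ^ 2 + t)⁻¹) t := by
    intro t ht
    have ht : 0 < t := ht
    have h := (((Real.hasDerivAt_sqrt ht.ne').div_const q).arctan).const_mul (2 / q)
    refine h.congr_deriv ?_
    have h1 : √t ^ 2 = t := Real.sq_sqrt ht.le
    have h2 : 0 < √t := Real.sqrt_pos.2 ht
    rw [div_pow, h1]
    field_simp
  have hnn : ∀ t ∈ Ioi (0 : ℝ), 0 ≤ (√t)⁻¹ * (q ^ 2 + t)⁻¹ := by
    intro t ht
    have ht : 0 < t := ht
    positivity
  have hlim : Tendsto (fun t : ℝ => 2 / q * Real.arctan (√t / q)) atTop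
      (𝓝 (2 / q * (Real.pi / 2))) := by
    refine Tendsto.const_mul _ ?_
    exact (Real.tendsto_arctan_atTop.mono_right nhdsWithin_le_nhds).comp
      (Real.tendsto_sqrt_atTop.atTop_div_const hq)
  refine ⟨integrableOn_Ioi_deriv_of_nonneg hcont hderiv hnn hlim, ?_⟩
  rw [integral_Ioi_of_hasDerivAt_of_nonneg hcont hderiv hnn hlim]
  simp only [Real.sqrt_zero, zero_div, Real.arctan_zero, mul_zero, sub_zero]
  field_simp

theorem integrableOn_inv_sqrt_mul_inv_one_add :
    IntegrableOn (fun t : ℝ => (√t)⁻¹ * (1 + t)⁻¹) (Ioi 0) := by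
  simpa using (integral_inv_sqrt_mul_inv_sq_add one_pos).1

theorem norm_inv_ofReal_sqrt (t : ℝ) : ‖((√t : ℝ) : ℂ)⁻¹‖ = (√t)⁻¹ := by
  rw [norm_inv, Complex.norm_real, Real.norm_of_nonneg (Real.sqrt_nonneg t)]

theorem inv_sqrt_mul_inv_one_add_sq_le {t : ℝ} (ht : 0 < t) :
    (√t)⁻¹ * ((1 + t)⁻¹ * (1 + t)⁻¹) ≤ (√t)⁻¹ * (1 + t)⁻¹ := by
  have h1 : (1 + t)⁻¹ ≤ 1 := inv_le_one_of_one_le₀ (by linarith)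
  have h2 : 0 ≤ (1 + t)⁻¹ := by positivity
  gcongr
  nlinarith

theorem sqrt_mul_inv_one_add_sq_le {t : ℝ} (ht : 0 < t) :
    √t * ((1 + t)⁻¹ * (1 + t)⁻¹) ≤ (√t)⁻¹ * (1 + t)⁻¹ := by
  have h2 : 0 < √t := Real.sqrt_pos.2 ht
  have h1 : √t * √t = t := Real.mul_self_sqrt ht.le
  rw [← sub_nonneg]
  have : (√t)⁻¹ * (1 + t)⁻¹ - √t * ((1 + t)⁻¹ * (1 + t)⁻¹)
      = (√t)⁻¹ * ((1 + t)⁻¹ * (1 + t)⁻¹) := by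
    field_simp
    rw [Real.sq_sqrt ht.le]
    ring
  rw [this]
  positivity

namespace IsResolventFamily

variable {R : ℂ → 𝓐} {G : Set ℂ} {z w : ℂ}

theorem exists_locally_bound (h : IsResolventFamily R G) (hz : z ∈ G) :
    ∃ C : ℝ, 0 ≤ C ∧ ∀ᶠ w in 𝓝 z,
      w ∈ G ∧ ∀ t : ℝ, 0 ≤ t → ‖R (w - t)‖ ≤ C * (1 + t)⁻¹ := by
  obtain ⟨C, hC⟩ := h.eventually_bound z hz
  refine ⟨C, ?_, ?_⟩
  · have := hC.self_of_nhds.2 0 le_rfl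
    exact le_trans (by positivity) this
  · filter_upwards [hC] with w hw
    refine ⟨hw.1, fun t ht => ?_⟩
    rw [← div_eq_mul_inv, le_div_iff₀ (by linarith), mul_comm]
    exact hw.2 t ht

theorem exists_bound (h : IsResolventFamily R G) (hz : z ∈ G) :
    ∃ C : ℝ, 0 ≤ C ∧ ∀ t : ℝ, 0 ≤ t → ‖R (z - t)‖ ≤ C * (1 + t)⁻¹ := by
  obtain ⟨C, hC0, hC⟩ := h.exists_locally_bound hz
  exact ⟨C, hC0, hC.self_of_nhds.2⟩

theorem commute (h : IsResolventFamily R G) (hz : z ∈ G) (hw : w ∈ G) :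
    Commute (R z) (R w) := by
  rcases eq_or_ne z w with rfl | hne
  · exact Commute.refl _
  · have h1 := h.sub_eq z hz w hw
    have h2 := h.sub_eq w hw z hz
    have h3 : (z - w) • (R z * R w) = (z - w) • (R w * R z) := by
      rw [← h1, ← neg_sub (R w) (R z), h2, ← neg_smul, neg_sub]
    exact smul_right_injective _ (sub_ne_zero.2 hne) h3

theorem mul_sub (h : IsResolventFamily R G) (hz : z ∈ G) {t : ℝ} (ht : 0 ≤ t) :
    (t : ℂ) • (R z * R (z - t)) = R z - R (z - t) := by
  rw [h.sub_eq z hz _ (h.sub_mem z hz t ht)]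
  simp

theorem hasDerivAt (h : IsResolventFamily R G) (hz : z ∈ G) :
    HasDerivAt R (R z * R z) z := by
  obtain ⟨C, hC0, hC⟩ := h.exists_locally_bound hz
  have hC' : ∀ᶠ w in 𝓝 z, w ∈ G ∧ ‖R w‖ ≤ C := by
    filter_upwards [hC] with w hw
    exact ⟨hw.1, by simpa using hw.2 0 le_rfl⟩
  have hcont : Tendsto R (𝓝 z) (𝓝 (R z)) := by
    rw [tendsto_iff_norm_sub_tendsto_zero]
    refine squeeze_zero' (g := fun w => ‖w - z‖ * (C * C)) (.of_forall fun _ => norm_nonneg _) ?_ ?_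
    · filter_upwards [hC'] with w hw
      rw [h.sub_eq w hw.1 z hz, norm_smul]
      gcongr
      refine (norm_mul_le _ _).trans ?_
      gcongr
      exacts [hw.2, hC'.self_of_nhds.2]
    · have : Continuous fun w : ℂ => ‖w - z‖ * (C * C) := by fun_prop
      simpa using this.tendsto z
  rw [hasDerivAt_iff_tendsto_slope]
  refine ((hcont.mono_left nhdsWithin_le_nhds).mul_const (R z)).congr' ?_
  filter_upwards [hC'.filter_mono nhdsWithin_le_nhds, self_mem_nhdsWithin] with w hw hne
  rw [slope_def_module, h.sub_eq w hw.1 z hz, smul_smul,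
    inv_mul_cancel₀ (sub_ne_zero.2 hne), one_smul]

theorem hasDerivAt_sub_ofReal (h : IsResolventFamily R G) {t : ℝ} (hz : z - t ∈ G) :
    HasDerivAt (fun t : ℝ => R (z - t)) (-(R (z - t) * R (z - t))) t := by
  have h1 : HasDerivAt (fun t : ℝ => z - (t : ℂ)) (-1) t :=
    (Complex.ofRealCLM.hasDerivAt (x := t)).const_sub z |>.congr_deriv (by simp)
  exact ((h.hasDerivAt hz).scomp t h1).congr_deriv (by simp)

theorem hasDerivAt_sub_const (h : IsResolventFamily R G) {t : ℝ} (hz : z - t ∈ G) :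
    HasDerivAt (fun z : ℂ => R (z - t)) (R (z - t) * R (z - t)) z := by
  exact ((h.hasDerivAt hz).scomp z ((hasDerivAt_id z).sub_const (t : ℂ))).congr_deriv (by simp)

theorem continuousOn (h : IsResolventFamily R G) (hz : z ∈ G) :
    ContinuousOn (fun t : ℝ => R (z - t)) (Ici 0) := fun t ht =>
  (h.hasDerivAt_sub_ofReal (h.sub_mem z hz t ht)).continuousAt.continuousWithinAt

theorem aestronglyMeasurable (h : IsResolventFamily R G) (hz : z ∈ G) :
    AEStronglyMeasurable (fun t : ℝ => R (z - t)) (volume.restrict (Ioi 0)) :=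
  ((h.continuousOn hz).mono Ioi_subset_Ici_self).aestronglyMeasurable measurableSet_Ioi

theorem integrableOn_inv_sqrt_smul (h : IsResolventFamily R G) (hz : z ∈ G) :
    IntegrableOn (fun t : ℝ => ((√t : ℝ) : ℂ)⁻¹ • R (z - t)) (Ioi 0) := by
  obtain ⟨C, hC0, hC⟩ := h.exists_bound hz
  refine (integrableOn_inv_sqrt_mul_inv_one_add.const_mul C).mono' ?_ ?_
  · exact (by fun_prop : Measurable fun t : ℝ => ((√t : ℝ) : ℂ)⁻¹).aestronglyMeasurable.smul
      (h.aestronglyMeasurable hz)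
  · filter_upwards [ae_restrict_mem measurableSet_Ioi] with t ht
    have ht : 0 < t := ht
    rw [norm_smul, norm_inv_ofReal_sqrt]
    calc (√t)⁻¹ * ‖R (z - t)‖ ≤ (√t)⁻¹ * (C * (1 + t)⁻¹) := by gcongr; exact hC t ht.le
      _ = _ := by ring

theorem commute_sqrtIntegral (h : IsResolventFamily R G) (hz : z ∈ G) {x : 𝓐}
    (hx : ∀ w ∈ G, Commute x (R w)) : Commute x (sqrtIntegral R z) := by
  refine Commute.smul_right ?_ _
  have hi := h.integrableOn_inv_sqrt_smul hz
  rw [Commute, SemiconjBy, ← integral_const_mul_of_integrable hi,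
    ← integral_mul_const_of_integrable hi]
  refine setIntegral_congr_fun measurableSet_Ioi fun t ht => ?_
  exact (hx _ (h.sub_mem z hz t (le_of_lt ht))).smul_right _

theorem commute_sqrtIntegral_left (h : IsResolventFamily R G) (hz : z ∈ G) (hw : w ∈ G) :
    Commute (R w) (sqrtIntegral R z) :=
  h.commute_sqrtIntegral hz fun _ hw' => h.commute hw hw'

theorem commute_sqrtIntegral_sqrtIntegral (h : IsResolventFamily R G) (hz : z ∈ G)
    (hw : w ∈ G) : Commute (sqrtIntegral R w) (sqrtIntegral R z) :=
  h.commute_sqrtIntegral hz fun _ hw' => (h.commute_sqrtIntegral_left hw hw').symm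

theorem integrableOn_sqrt_smul_sub (h : IsResolventFamily R G) (hw : w ∈ G) (hz : z ∈ G) :
    IntegrableOn (fun t : ℝ => ((√t : ℝ) : ℂ) • (R (w - t) - R (z - t))) (Ioi 0) := by
  obtain ⟨C, hC0, hC⟩ := h.exists_bound hz
  obtain ⟨C', hC0', hC'⟩ := h.exists_bound hw
  refine (integrableOn_inv_sqrt_mul_inv_one_add.const_mul (‖w - z‖ * (C' * C))).mono' ?_ ?_
  · exact (by fun_prop : Measurable fun t : ℝ => ((√t : ℝ) : ℂ)).aestronglyMeasurable.smul
      ((h.aestronglyMeasurable hw).sub (h.aestronglyMeasurable hz))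
  · filter_upwards [ae_restrict_mem measurableSet_Ioi] with t ht
    have ht : 0 < t := ht
    rw [h.sub_eq _ (h.sub_mem w hw t ht.le) _ (h.sub_mem z hz t ht.le), sub_sub_sub_cancel_right,
      norm_smul, norm_smul, Complex.norm_real, Real.norm_of_nonneg (Real.sqrt_nonneg t)]
    calc √t * (‖w - z‖ * ‖R (w - t) * R (z - t)‖)
        ≤ √t * (‖w - z‖ * ((C' * (1 + t)⁻¹) * (C * (1 + t)⁻¹))) := by
          gcongr
          refine (norm_mul_le _ _).trans ?_
          gcongr
          exacts [hC' t ht.le, hC t ht.le]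
      _ = ‖w - z‖ * (C' * C) * (√t * ((1 + t)⁻¹ * (1 + t)⁻¹)) := by ring
      _ ≤ _ := by gcongr ‖w - z‖ * (C' * C) * ?_; exact sqrt_mul_inv_one_add_sq_le ht

theorem mul_mul_sqrtDiff (h : IsResolventFamily R G) (hw : w ∈ G) (hz : z ∈ G) :
    R z * R w * sqrtDiff R w z = R w * sqrtIntegral R z - R z * sqrtIntegral R w := by
  have hiz := h.integrableOn_inv_sqrt_smul hz
  have hiw := h.integrableOn_inv_sqrt_smul hw
  simp only [sqrtDiff, sqrtIntegral, mul_smul_comm, ← smul_sub]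
  congr 1
  rw [← integral_const_mul_of_integrable (h.integrableOn_sqrt_smul_sub hw hz),
    ← integral_const_mul_of_integrable hiz, ← integral_const_mul_of_integrable hiw,
    ← integral_sub (hiz.const_mul _) (hiw.const_mul _)]
  refine setIntegral_congr_fun measurableSet_Ioi fun t ht => ?_
  have ht : 0 < t := ht
  have h1 := h.mul_sub hz ht.le
  have h2 := h.mul_sub hw ht.le
  have hc : R z * R w = R w * R z := h.commute hz hw
  have h3 : ((√t : ℝ) : ℂ) ≠ 0 := by exact_mod_cast (Real.sqrt_pos.2 ht).ne'
  have h5 : ((√t : ℝ) : ℂ) = ((√t : ℝ) : ℂ)⁻¹ * (t : ℂ) := by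
    rw [eq_inv_mul_iff_mul_eq₀ h3, ← Complex.ofReal_mul, Real.mul_self_sqrt ht.le]
  have h6 : R z * R w * R (w - t) = R z * (R w * R (w - t)) := mul_assoc _ _ _
  have h7 : R z * R w * R (z - t) = R w * (R z * R (z - t)) := by rw [hc, mul_assoc]
  calc R z * R w * (((√t : ℝ) : ℂ) • (R (w - t) - R (z - t)))
      = ((√t : ℝ) : ℂ)⁻¹ • (R z * ((t : ℂ) • (R w * R (w - t))) -
          R w * ((t : ℂ) • (R z * R (z - t)))) := by
        rw [mul_smul_comm, _root_.mul_sub, h6, h7, h5, mul_smul, smul_sub (t : ℂ), mul_smul_comm,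
          mul_smul_comm, ← h5]
    _ = _ := by
        rw [h1, h2]
        simp only [_root_.mul_sub, mul_smul_comm, hc, smul_sub]
        abel

theorem hasDerivAt_sqrtIntegral_aux (h : IsResolventFamily R G) (hz : z ∈ G) :
    IntegrableOn (fun t : ℝ => ((√t : ℝ) : ℂ)⁻¹ • (R (z - t) * R (z - t))) (Ioi 0) ∧
      HasDerivAt (fun z => ∫ t in Ioi (0 : ℝ), ((√t : ℝ) : ℂ)⁻¹ • R (z - t))
        (∫ t in Ioi (0 : ℝ), ((√t : ℝ) : ℂ)⁻¹ • (R (z - t) * R (z - t))) z := by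
  obtain ⟨C, hC0, hC⟩ := h.exists_locally_bound hz
  refine hasDerivAt_integral_of_dominated_loc_of_deriv_le (μ := volume.restrict (Ioi 0))
    (F := fun z t => ((√t : ℝ) : ℂ)⁻¹ • R (z - (t : ℂ)))
    (F' := fun z t => ((√t : ℝ) : ℂ)⁻¹ • (R (z - (t : ℂ)) * R (z - (t : ℂ)))) hC ?_
    (h.integrableOn_inv_sqrt_smul hz) ?_ (bound := fun t => C ^ 2 * ((√t)⁻¹ * (1 + t)⁻¹))
    ?_ (integrableOn_inv_sqrt_mul_inv_one_add.const_mul _) ?_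
  · filter_upwards [hC] with w hw
    exact (h.integrableOn_inv_sqrt_smul hw.1).aestronglyMeasurable
  · exact (by fun_prop : Measurable fun t : ℝ => ((√t : ℝ) : ℂ)⁻¹).aestronglyMeasurable.smul
      ((h.aestronglyMeasurable hz).mul (h.aestronglyMeasurable hz))
  · filter_upwards [ae_restrict_mem measurableSet_Ioi] with t ht w hw
    have ht : 0 < t := ht
    rw [norm_smul, norm_inv_ofReal_sqrt]
    calc (√t)⁻¹ * ‖R (w - t) * R (w - t)‖
        ≤ (√t)⁻¹ * ((C * (1 + t)⁻¹) * (C * (1 + t)⁻¹)) := by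
          gcongr
          refine (norm_mul_le _ _).trans ?_
          gcongr <;> exact hw.2 t ht.le
      _ = C ^ 2 * ((√t)⁻¹ * ((1 + t)⁻¹ * (1 + t)⁻¹)) := by ring
      _ ≤ _ := by gcongr C ^ 2 * ?_; exact inv_sqrt_mul_inv_one_add_sq_le ht
  · filter_upwards [ae_restrict_mem measurableSet_Ioi] with t ht w hw
    exact (h.hasDerivAt_sub_const (h.sub_mem w hw.1 t (le_of_lt ht))).fun_const_smul
      (((√t : ℝ) : ℂ)⁻¹)

theorem differentiableOn_sqrtDiff (h : IsResolventFamily R G) (hw : w ∈ G) :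
    DifferentiableOn ℂ (sqrtDiff R w) G := by
  intro z hz
  obtain ⟨C, hC0, hC⟩ := h.exists_locally_bound hz
  have key := hasDerivAt_integral_of_dominated_loc_of_deriv_le (μ := volume.restrict (Ioi 0))
    (F := fun z t => ((√t : ℝ) : ℂ) • (R (w - (t : ℂ)) - R (z - (t : ℂ))))
    (F' := fun z t => ((√t : ℝ) : ℂ) • -(R (z - (t : ℂ)) * R (z - (t : ℂ)))) hC ?_
    (h.integrableOn_sqrt_smul_sub hw hz) ?_ (bound := fun t => C ^ 2 * ((√t)⁻¹ * (1 + t)⁻¹))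
    ?_ (integrableOn_inv_sqrt_mul_inv_one_add.const_mul _) ?_
  · exact (key.2.fun_const_smul (Real.pi : ℂ)⁻¹).differentiableAt.differentiableWithinAt
  · filter_upwards [hC] with z hz
    exact (h.integrableOn_sqrt_smul_sub hw hz.1).aestronglyMeasurable
  · exact (by fun_prop : Measurable fun t : ℝ => ((√t : ℝ) : ℂ)).aestronglyMeasurable.smul
      ((h.aestronglyMeasurable hz).mul (h.aestronglyMeasurable hz)).neg
  · filter_upwards [ae_restrict_mem measurableSet_Ioi] with t ht z hz
    have ht : 0 < t := ht
    rw [norm_smul, norm_neg, Complex.norm_real, Real.norm_of_nonneg (Real.sqrt_nonneg t)]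
    calc √t * ‖R (z - t) * R (z - t)‖
        ≤ √t * ((C * (1 + t)⁻¹) * (C * (1 + t)⁻¹)) := by
          gcongr
          refine (norm_mul_le _ _).trans ?_
          gcongr <;> exact hz.2 t ht.le
      _ = C ^ 2 * (√t * ((1 + t)⁻¹ * (1 + t)⁻¹)) := by ring
      _ ≤ _ := by gcongr C ^ 2 * ?_; exact sqrt_mul_inv_one_add_sq_le ht
  · filter_upwards [ae_restrict_mem measurableSet_Ioi] with t ht z hz
    exact ((h.hasDerivAt_sub_const (h.sub_mem z hz.1 t (le_of_lt ht))).const_sub _).fun_const_smul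
      ((√t : ℝ) : ℂ)

variable [CompleteSpace 𝓐]

theorem integral_inv_sqrt_smul_sq (h : IsResolventFamily R G) (hz : z ∈ G) :
    ∫ t in Ioi (0 : ℝ), ((√t : ℝ) : ℂ)⁻¹ • (R (z - t) * R (z - t)) =
      (1 / 2 : ℂ) • (R z * ∫ t in Ioi (0 : ℝ), ((√t : ℝ) : ℂ)⁻¹ • R (z - t)) := by
  obtain ⟨C, hC0, hC⟩ := h.exists_bound hz
  have hi := h.integrableOn_inv_sqrt_smul hz
  have hi2 := (h.hasDerivAt_sqrtIntegral_aux hz).1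
  have hi3 : IntegrableOn
      (fun t : ℝ => (1 / 2 : ℂ) • (R z * (((√t : ℝ) : ℂ)⁻¹ • R (z - t)))) (Ioi 0) :=
    (hi.const_mul (R z)).smul (1 / 2 : ℂ)
  rw [← integral_const_mul_of_integrable hi, ← integral_smul, ← sub_eq_zero,
    ← integral_sub hi2 hi3]
  have key := integral_Ioi_of_hasDerivAt_of_tendsto (a := 0) (m := 0)
    (f := fun t : ℝ => ((√t : ℝ) : ℂ) • (R z * R (z - t)))
    (f' := fun t : ℝ => ((√t : ℝ) : ℂ)⁻¹ • (R (z - t) * R (z - t)) -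
      (1 / 2 : ℂ) • (R z * (((√t : ℝ) : ℂ)⁻¹ • R (z - t)))) ?_ ?_ (hi2.sub hi3) ?_
  · simpa using key
  · refine ContinuousWithinAt.smul ?_ (((h.continuousOn hz) 0 self_mem_Ici).const_mul _)
    exact (by fun_prop : Continuous fun t : ℝ => ((√t : ℝ) : ℂ)).continuousWithinAt
  · intro t ht
    have ht : 0 < t := ht
    have h1 := ((Real.hasDerivAt_sqrt ht.ne').ofReal_comp).smul
      ((h.hasDerivAt_sub_ofReal (h.sub_mem z hz t ht.le)).const_mul (R z))
    refine h1.congr_deriv ?_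
    have h2 : R z * (R (z - t) * R (z - t)) =
        (t : ℂ)⁻¹ • (R z * R (z - t) - R (z - t) * R (z - t)) := by
      rw [← sub_mul, ← h.mul_sub hz ht.le, smul_mul_assoc, smul_smul, inv_mul_cancel₀, one_smul,
        mul_assoc]
      exact_mod_cast ht.ne'
    have h3 : 0 < √t := Real.sqrt_pos.2 ht
    have h4 : ((√t : ℝ) : ℂ) ≠ 0 := by exact_mod_cast h3.ne'
    have h5 : (t : ℂ) = (√t : ℝ) * (√t : ℝ) := by
      rw [← Complex.ofReal_mul, Real.mul_self_sqrt ht.le]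
    rw [mul_neg, h2, mul_smul_comm]
    generalize R z * R (z - t) = X
    generalize R (z - t) * R (z - t) = Y
    simp only [h5]
    push_cast
    match_scalars <;> field_simp
    ring
  · refine squeeze_zero_norm' (a := fun t : ℝ => ‖R z‖ * C * (√t)⁻¹) ?_ ?_
    · filter_upwards [eventually_gt_atTop 0] with t ht
      rw [norm_smul, Complex.norm_real, Real.norm_of_nonneg (Real.sqrt_nonneg t)]
      have h1 : √t * (1 + t)⁻¹ ≤ (√t)⁻¹ := by
        have h3 : 0 < √t := Real.sqrt_pos.2 ht
        rw [← div_eq_mul_inv, div_le_iff₀ (by linarith), ← div_eq_inv_mul, le_div_iff₀ h3,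
          Real.mul_self_sqrt ht.le]
        linarith
      calc √t * ‖R z * R (z - t)‖ ≤ √t * (‖R z‖ * (C * (1 + t)⁻¹)) := by
            gcongr
            refine (norm_mul_le _ _).trans ?_
            gcongr
            exact hC t ht.le
        _ = ‖R z‖ * C * (√t * (1 + t)⁻¹) := by ring
        _ ≤ _ := by gcongr
    · simpa using (tendsto_inv_atTop_zero.comp Real.tendsto_sqrt_atTop).const_mul (‖R z‖ * C)

theorem hasDerivAt_sqrtIntegral (h : IsResolventFamily R G) (hz : z ∈ G) :
    HasDerivAt (sqrtIntegral R) ((1 / 2 : ℂ) • (R z * sqrtIntegral R z)) z := by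
  refine ((h.hasDerivAt_sqrtIntegral_aux hz).2.fun_const_smul (Real.pi : ℂ)⁻¹).congr_deriv ?_
  rw [h.integral_inv_sqrt_smul_sq hz, sqrtIntegral, mul_smul_comm, smul_comm]

theorem hasDerivAt_sqrtIntegral_sub_ofReal (h : IsResolventFamily R G) {t : ℝ}
    (hz : z - t ∈ G) :
    HasDerivAt (fun t : ℝ => sqrtIntegral R (z - t))
      (-((1 / 2 : ℂ) • (R (z - t) * sqrtIntegral R (z - t)))) t := by
  have h1 : HasDerivAt (fun t : ℝ => z - (t : ℂ)) (-1) t :=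
    (Complex.ofRealCLM.hasDerivAt (x := t)).const_sub z |>.congr_deriv (by simp)
  exact ((h.hasDerivAt_sqrtIntegral hz).scomp t h1).congr_deriv (neg_one_smul ℂ _)

/-- Along the ray `z - r`, the product `(1 + r R z) (sqrtIntegral R (z - r))²` is constant. -/
theorem one_add_smul_mul_sqrtIntegral_sq (h : IsResolventFamily R G) (hz : z ∈ G) {r : ℝ}
    (hr : 0 ≤ r) :
    (1 + (r : ℂ) • R z) * (sqrtIntegral R (z - r) * sqrtIntegral R (z - r)) =
      sqrtIntegral R z * sqrtIntegral R z := by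
  have hderiv : ∀ t : ℝ, 0 ≤ t → HasDerivAt (fun t : ℝ => (1 + (t : ℂ) • R z) *
      (sqrtIntegral R (z - t) * sqrtIntegral R (z - t))) 0 t := by
    intro t ht
    have hzt := h.sub_mem z hz t ht
    have hS := h.hasDerivAt_sqrtIntegral_sub_ofReal hzt
    have hE : HasDerivAt (fun t : ℝ => 1 + (t : ℂ) • R z) (R z) t := by
      refine (((Complex.ofRealCLM.hasDerivAt (x := t)).smul_const (R z)).const_add 1).congr_deriv ?_
      simp
    refine (hE.mul (hS.mul hS)).congr_deriv ?_
    have hc : R (z - t) * sqrtIntegral R (z - t) = sqrtIntegral R (z - t) * R (z - t) :=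
      h.commute_sqrtIntegral_left hzt hzt
    have hER : (1 + (t : ℂ) • R z) * R (z - t) = R z := by
      rw [add_mul, smul_mul_assoc, h.mul_sub hz ht]
      simp
    change R z * (sqrtIntegral R (z - t) * sqrtIntegral R (z - t)) + _ = 0
    generalize sqrtIntegral R (z - t) = S at *
    have h1 : -((1 / 2 : ℂ) • (R (z - t) * S)) * S + S * -((1 / 2 : ℂ) • (R (z - t) * S)) =
        -(R (z - t) * (S * S)) := by
      have : S * (R (z - t) * S) = R (z - t) * (S * S) := by
        rw [← mul_assoc, ← hc, mul_assoc]
      rw [neg_mul, mul_neg, smul_mul_assoc, mul_smul_comm, this, mul_assoc]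
      module
    rw [h1, mul_neg, ← mul_assoc (1 + (t : ℂ) • R z), hER, add_neg_cancel]
  have := constant_of_has_deriv_right_zero (a := 0) (b := r)
    (fun t ht => (hderiv t ht.1).continuousAt.continuousWithinAt)
    (fun t ht => (hderiv t ht.1).hasDerivWithinAt) r ⟨hr, le_rfl⟩
  simpa using this

theorem sqrtIntegral_sub_sq_bounds (h : IsResolventFamily R G) (hz : z ∈ G) :
    ∃ C : ℝ, 0 ≤ C ∧ ∀ q : ℝ, 0 < q →
      ‖(q : ℂ) • sqrtIntegral R (z - (q ^ 2 : ℝ))‖ ≤ C ∧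
      ‖(q : ℂ) • (sqrtIntegral R (z - (q ^ 2 : ℝ)) * R z) - R z‖ ≤ C / q ^ 2 := by
  obtain ⟨C, hC0, hC⟩ := h.exists_bound hz
  refine ⟨C, hC0, fun q hq => ?_⟩
  obtain ⟨hk, hkint⟩ := integral_inv_sqrt_mul_inv_sq_add hq
  have hzq := h.sub_mem z hz (q ^ 2) (by positivity)
  have hi := h.integrableOn_inv_sqrt_smul hzq
  have hR : ∀ t : ℝ, 0 < t → ‖R (z - (q ^ 2 : ℝ) - t)‖ ≤ C * (q ^ 2 + t)⁻¹ := by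
    intro t ht
    rw [sub_sub, ← Complex.ofReal_add]
    refine (hC _ (by positivity)).trans (mul_le_mul_of_nonneg_left ?_ hC0)
    exact inv_anti₀ (by positivity) (by linarith)
  have hpi : (0 : ℝ) < Real.pi := Real.pi_pos
  constructor
  · rw [sqrtIntegral, norm_smul, norm_smul, Complex.norm_real, Real.norm_of_nonneg hq.le,
      norm_inv, Complex.norm_real, Real.norm_of_nonneg hpi.le]
    have : ‖∫ t in Ioi (0 : ℝ), ((√t : ℝ) : ℂ)⁻¹ • R (z - (q ^ 2 : ℝ) - t)‖ ≤
        C * (Real.pi / q) := by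
      rw [← hkint, ← integral_const_mul]
      refine norm_integral_le_of_norm_le (hk.const_mul C) ?_
      filter_upwards [ae_restrict_mem measurableSet_Ioi] with t ht
      rw [norm_smul, norm_inv_ofReal_sqrt, mul_left_comm]
      gcongr
      exact hR t ht
    calc _ ≤ q * (Real.pi⁻¹ * (C * (Real.pi / q))) := by gcongr
      _ = C := by field_simp
  · have hkc : IntegrableOn (fun t : ℝ => (((√t)⁻¹ * (q ^ 2 + t)⁻¹ : ℝ) : ℂ) • R z) (Ioi 0) :=
      (hk.ofReal (𝕜 := ℂ)).smul_const (R z)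
    have hkcint : ∫ t in Ioi (0 : ℝ), (((√t)⁻¹ * (q ^ 2 + t)⁻¹ : ℝ) : ℂ) =
        ((Real.pi / q : ℝ) : ℂ) := by
      rw [← hkint]
      exact integral_ofReal
    have hsum : sqrtIntegral R (z - (q ^ 2 : ℝ)) * R z - (q : ℂ)⁻¹ • R z = (Real.pi : ℂ)⁻¹ •
        ∫ t in Ioi (0 : ℝ), (((√t : ℝ) : ℂ)⁻¹ • R (z - (q ^ 2 : ℝ) - t) * R z -
          (((√t)⁻¹ * (q ^ 2 + t)⁻¹ : ℝ) : ℂ) • R z) := by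
      rw [integral_sub (hi.mul_const _) hkc, integral_mul_const_of_integrable hi,
        integral_smul_const, hkcint, smul_sub, sqrtIntegral, smul_mul_assoc,
        smul_smul]
      congr 2
      push_cast
      have : (Real.pi : ℂ) ≠ 0 := by exact_mod_cast hpi.ne'
      field_simp
    have hfac : (q : ℂ) • (sqrtIntegral R (z - (q ^ 2 : ℝ)) * R z) - R z =
        (q : ℂ) • (sqrtIntegral R (z - (q ^ 2 : ℝ)) * R z - (q : ℂ)⁻¹ • R z) := by
      rw [smul_sub, smul_smul, mul_inv_cancel₀ (by exact_mod_cast hq.ne'), one_smul]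
    rw [hfac, hsum, norm_smul, norm_smul, Complex.norm_real, Real.norm_of_nonneg hq.le,
      norm_inv, Complex.norm_real, Real.norm_of_nonneg hpi.le]
    have hle : ‖∫ t in Ioi (0 : ℝ), (((√t : ℝ) : ℂ)⁻¹ • R (z - (q ^ 2 : ℝ) - t) * R z -
          (((√t)⁻¹ * (q ^ 2 + t)⁻¹ : ℝ) : ℂ) • R z)‖ ≤ C / q ^ 2 * (Real.pi / q) := by
      rw [← hkint, ← integral_const_mul]
      refine norm_integral_le_of_norm_le (hk.const_mul _) ?_
      filter_upwards [ae_restrict_mem measurableSet_Ioi] with t ht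
      have ht : 0 < t := ht
      have hp : (0 : ℝ) < q ^ 2 + t := by positivity
      have h1 : R (z - (q ^ 2 : ℝ) - t) * R z =
          ((q ^ 2 + t : ℝ) : ℂ)⁻¹ • (R z - R (z - (q ^ 2 : ℝ) - t)) := by
        rw [sub_sub, ← Complex.ofReal_add, ← h.mul_sub hz hp.le, smul_smul, inv_mul_cancel₀
          (by exact_mod_cast hp.ne'), one_smul]
        exact h.commute (h.sub_mem z hz _ hp.le) hz
      have h2 : ((√t : ℝ) : ℂ)⁻¹ • R (z - (q ^ 2 : ℝ) - t) * R z -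
          (((√t)⁻¹ * (q ^ 2 + t)⁻¹ : ℝ) : ℂ) • R z =
          -((((√t)⁻¹ * (q ^ 2 + t)⁻¹ : ℝ) : ℂ) • R (z - (q ^ 2 : ℝ) - t)) := by
        rw [smul_mul_assoc, h1]
        push_cast
        module
      rw [h2, norm_neg, norm_smul, Complex.norm_real, Real.norm_of_nonneg (by positivity), mul_comm]
      gcongr
      refine (hR t ht).trans ?_
      rw [div_eq_mul_inv]
      gcongr
      linarith
    calc _ ≤ q * (Real.pi⁻¹ * (C / q ^ 2 * (Real.pi / q))) := by gcongr
      _ = C / q ^ 2 := by field_simp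

theorem sqrtIntegral_mul_self (h : IsResolventFamily R G) (hz : z ∈ G) :
    sqrtIntegral R z * sqrtIntegral R z = R z := by
  obtain ⟨C, hC0, hC⟩ := h.sqrtIntegral_sub_sq_bounds hz
  have hbound : ∀ q : ℝ, 0 < q →
      ‖sqrtIntegral R z * sqrtIntegral R z * R z - R z * R z‖ ≤
        (C * C * ‖R z‖ + ‖R z‖ * (C * C + C)) * (q ^ 2)⁻¹ := by
    intro q hq
    obtain ⟨h1, h2⟩ := hC q hq
    rw [← h.one_add_smul_mul_sqrtIntegral_sq hz (sq_nonneg q)]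
    set S := sqrtIntegral R (z - (q ^ 2 : ℝ))
    have hq0 : (q : ℂ) ≠ 0 := by exact_mod_cast hq.ne'
    have hsplit : (1 + ((q ^ 2 : ℝ) : ℂ) • R z) * (S * S) * R z - R z * R z =
        ((q ^ 2 : ℝ) : ℂ)⁻¹ • (((q : ℂ) • S) * ((q : ℂ) • S) * R z) +
          R z * (((q : ℂ) • S) * ((q : ℂ) • (S * R z) - R z) +
            ((q : ℂ) • (S * R z) - R z)) := by
      simp only [add_mul, mul_add, _root_.mul_sub, smul_mul_assoc, mul_smul_comm, one_mul,
        mul_assoc]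
      push_cast
      match_scalars <;> first | (field_simp; done) | (field_simp; ring)
    have hnq : ‖((q ^ 2 : ℝ) : ℂ)⁻¹‖ = (q ^ 2)⁻¹ := by
      rw [norm_inv, Complex.norm_real, Real.norm_of_nonneg (sq_nonneg q)]
    rw [hsplit]
    calc _ ≤ (q ^ 2)⁻¹ * (C * C * ‖R z‖) + ‖R z‖ * (C * (C / q ^ 2) + C / q ^ 2) := by
          refine (norm_add_le _ _).trans (add_le_add ?_ ?_)
          · rw [norm_smul, hnq]
            gcongr
            refine (norm_mul_le _ _).trans ?_
            gcongr
            refine (norm_mul_le _ _).trans ?_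
            gcongr
          · refine (norm_mul_le _ _).trans ?_
            gcongr
            refine (norm_add_le _ _).trans (add_le_add ?_ h2)
            refine (norm_mul_le _ _).trans ?_
            gcongr
      _ = _ := by ring
  have hlim : Tendsto (fun q : ℝ => (C * C * ‖R z‖ + ‖R z‖ * (C * C + C)) * (q ^ 2)⁻¹) atTop
      (𝓝 0) := by
    simpa using (tendsto_inv_atTop_zero.comp (tendsto_pow_atTop (α := ℝ) two_ne_zero)).const_mul
      (C * C * ‖R z‖ + ‖R z‖ * (C * C + C))
  have hzero : sqrtIntegral R z * sqrtIntegral R z * R z - R z * R z = 0 := by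
    refine norm_le_zero_iff.1 (ge_of_tendsto hlim ?_)
    filter_upwards [eventually_gt_atTop 0] with q hq using hbound q hq
  have hc := h.commute_sqrtIntegral_left hz hz
  have hcc : R z * (sqrtIntegral R z * sqrtIntegral R z) =
      sqrtIntegral R z * sqrtIntegral R z * R z := hc.mul_right hc
  rw [← sub_eq_zero]
  apply h.regular z hz
  rw [_root_.mul_sub, hcc, hzero]

theorem sqrtIntegral_regular (h : IsResolventFamily R G) (hz : z ∈ G) {x : 𝓐}
    (hx : sqrtIntegral R z * x = 0) : x = 0 := by
  apply h.regular z hz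
  rw [← h.sqrtIntegral_mul_self hz, mul_assoc, hx, mul_zero]

theorem sqrtIntegral_mul_sqrtIntegral_mul_sqrtDiff (h : IsResolventFamily R G) (hw : w ∈ G)
    (hz : z ∈ G) :
    sqrtIntegral R z * (sqrtIntegral R w * sqrtDiff R w z) =
      sqrtIntegral R w - sqrtIntegral R z := by
  have key := h.mul_mul_sqrtDiff hw hz
  have hc : sqrtIntegral R z * sqrtIntegral R w = sqrtIntegral R w * sqrtIntegral R z :=
    h.commute_sqrtIntegral_sqrtIntegral hw hz
  rw [← h.sqrtIntegral_mul_self hz, ← h.sqrtIntegral_mul_self hw] at key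
  rw [← sub_eq_zero]
  apply h.sqrtIntegral_regular hz
  apply h.sqrtIntegral_regular hw
  generalize sqrtIntegral R z = S at *
  generalize sqrtIntegral R w = T at *
  generalize sqrtDiff R w z = D at *
  have e1 : T * (S * (S * (T * D))) = S * S * (T * T) * D := by
    simp only [← mul_assoc]
    rw [← hc, mul_assoc S T S, ← hc, ← mul_assoc]
  have e2 : T * (S * T) = T * T * S := by rw [hc, mul_assoc]
  have e3 : T * (S * S) = S * S * T := by
    rw [← mul_assoc, ← hc, mul_assoc, ← hc, mul_assoc]
  rw [_root_.mul_sub, _root_.mul_sub, _root_.mul_sub, _root_.mul_sub, e1, key, e2, e3, sub_self]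

/-- The square roots `sqrtIntegral R z` for different `z` are related by analytic multipliers. -/
theorem exists_analytic_multipliers (h : IsResolventFamily R G) (hw : w ∈ G) :
    ∃ U V : ℂ → 𝓐, DifferentiableOn ℂ U G ∧ DifferentiableOn ℂ V G ∧ ∀ z ∈ G,
      sqrtIntegral R z * U z = sqrtIntegral R w ∧ sqrtIntegral R w * V z = sqrtIntegral R z := by
  have hD := h.differentiableOn_sqrtDiff hw
  have hS : DifferentiableOn ℂ (sqrtIntegral R) G := fun z hz =>
    (h.hasDerivAt_sqrtIntegral hz).differentiableAt.differentiableWithinAt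
  refine ⟨fun z => 1 + sqrtIntegral R w * sqrtDiff R w z,
    fun z => 1 - sqrtIntegral R z * sqrtDiff R w z,
    (differentiableOn_const 1).add ((differentiableOn_const _).mul hD),
    (differentiableOn_const 1).sub (hS.mul hD), fun z hz => ?_⟩
  have key := h.sqrtIntegral_mul_sqrtIntegral_mul_sqrtDiff hw hz
  have hc : sqrtIntegral R z * sqrtIntegral R w = sqrtIntegral R w * sqrtIntegral R z :=
    h.commute_sqrtIntegral_sqrtIntegral hw hz
  constructor
  · rw [mul_add, key, mul_one, add_sub_cancel]
  · rw [_root_.mul_sub, ← mul_assoc, ← hc, mul_assoc, key, mul_one, sub_sub_cancel]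

end IsResolventFamily
end ResolventFamily

section OperatorResolvent

open Set Topology

variable {A A0 : H →ₗ.[ℂ] H} {z w : ℂ} {T T' : H →L[ℂ] H} {G : Set ℂ} {t0 ω0 : ℝ}

namespace IsResolvent

omit [CompleteSpace H] in
theorem sub_eq (hT : IsResolvent A z T) (hT' : IsResolvent A w T') :
    T - T' = (z - w) • (T * T') := by
  ext x
  obtain ⟨hx, hAx⟩ := hT'.1 x
  have h1 := hT.2 ⟨T' x, hx⟩
  have h2 : A ⟨T' x, hx⟩ - z • T' x = x - (z - w) • T' x := by
    rw [sub_eq_iff_eq_add] at hAx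
    rw [hAx, sub_smul]
    abel
  simp only [h2, map_sub, map_smul] at h1
  simp only [_root_.sub_apply, _root_.smul_apply,
    mul_apply_eq_comp]
  nth_rewrite 1 [← h1]
  abel

omit [CompleteSpace H] in
theorem unique (hT : IsResolvent A z T) (hT' : IsResolvent A z T') : T = T' := by
  simpa [sub_eq_zero] using hT.sub_eq hT'

omit [CompleteSpace H] in
theorem res_eq (hT : IsResolvent A z T) : res A z = T := by
  have h : ∃ T, IsResolvent A z T := ⟨T, hT⟩
  rw [res, dif_pos h]
  exact h.choose_spec.unique hT

omit [CompleteSpace H] in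
theorem eq_zero_of_apply_eq_zero (hT : IsResolvent A z T) {x : H} (hx : T x = 0) : x = 0 := by
  obtain ⟨hm, hA⟩ := hT.1 x
  have h0 : (⟨T x, hm⟩ : A.domain) = 0 := Subtype.ext hx
  rw [h0, hx] at hA
  simpa using hA.symm

/-- The Neumann series: a resolvent at `z` yields one at every sufficiently close point. -/
theorem of_norm_lt_one (hT : IsResolvent A z T) (h : ‖(w - z) • T‖ < 1) :
    ∃ T', IsResolvent A w T' := by
  set N : (H →L[ℂ] H)ˣ := Units.oneSub ((w - z) • T) h with hN
  have hNval : (N : H →L[ℂ] H) = 1 - (w - z) • T := rfl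
  have hNapp : ∀ y, (N : H →L[ℂ] H) y = y - (w - z) • T y := fun y => by simp [hNval]
  refine ⟨T * ((N⁻¹ : (H →L[ℂ] H)ˣ) : H →L[ℂ] H), fun x => ?_, fun u => ?_⟩
  · obtain ⟨hm, hA⟩ := hT.1 (((N⁻¹ : (H →L[ℂ] H)ˣ) : H →L[ℂ] H) x)
    refine ⟨hm, ?_⟩
    have h1 : (N : H →L[ℂ] H) (((N⁻¹ : (H →L[ℂ] H)ˣ) : H →L[ℂ] H) x) = x := by
      rw [← mul_apply_eq_comp, Units.mul_inv, one_apply_eq_self]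
    rw [hNapp] at h1
    rw [sub_eq_iff_eq_add] at hA
    change A ⟨T _, hm⟩ - w • T _ = x
    rw [hA]
    nth_rewrite 4 [← h1]
    rw [sub_smul]
    abel
  · have hv := hT.2 u
    have h1 : A u - w • (u : H) = (N : H →L[ℂ] H) (A u - z • (u : H)) := by
      rw [hNapp, hv, sub_smul]
      abel
    rw [h1, mul_apply_eq_comp, ← mul_apply_eq_comp _ (N : H →L[ℂ] H),
      Units.inv_mul, one_apply_eq_self, hv]

theorem adjoint (hA : Dense (A.domain : Set H)) (hT : IsResolvent A z T) :
    IsResolvent A.adjoint (starRingEnd ℂ z) (ContinuousLinearMap.adjoint T) := by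
  refine ⟨fun x => ?_, fun u => ?_⟩
  · have key : ∀ u : A.domain, ⟪x + starRingEnd ℂ z • ContinuousLinearMap.adjoint T x, (u : H)⟫_ℂ =
        ⟪ContinuousLinearMap.adjoint T x, A u⟫_ℂ := by
      intro u
      have h1 := hT.2 u
      rw [map_sub, map_smul, sub_eq_iff_eq_add] at h1
      rw [ContinuousLinearMap.adjoint_inner_left, h1, inner_add_left, inner_add_right,
        inner_smul_left, inner_smul_right, ContinuousLinearMap.adjoint_inner_left]
      simp
    have hm : ContinuousLinearMap.adjoint T x ∈ A.adjoint.domain :=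
      LinearPMap.mem_adjoint_domain_of_exists _ ⟨_, key⟩
    refine ⟨hm, ?_⟩
    rw [LinearPMap.adjoint_apply_eq hA ⟨_, hm⟩ key]
    abel
  · refine ext_inner_right ℂ fun y => ?_
    obtain ⟨hm, hAy⟩ := hT.1 y
    have h1 := LinearPMap.adjoint_isFormalAdjoint hA u ⟨T y, hm⟩
    rw [ContinuousLinearMap.adjoint_inner_left, inner_sub_left, h1, inner_smul_left,
      Complex.conj_conj, ← inner_smul_right, ← inner_sub_right, hAy]

end IsResolvent

omit [CompleteSpace H] in
theorem isResolvent_shiftP_iff : IsResolvent (shiftP A w) z T ↔ IsResolvent A (z - w) T := by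
  have h (u : A.domain) : shiftP A w u - z • (u : H) = A u - (z - w) • (u : H) := by
    change A u + w • (u : H) - z • (u : H) = _
    rw [sub_smul]
    abel
  constructor
  · rintro ⟨h1, h2⟩
    refine ⟨fun x => ?_, fun u => ?_⟩
    · obtain ⟨hm, hx⟩ := h1 x
      exact ⟨hm, (h ⟨T x, hm⟩).symm.trans hx⟩
    · rw [← h u]
      exact h2 u
  · rintro ⟨h1, h2⟩
    refine ⟨fun x => ?_, fun u => ?_⟩
    · obtain ⟨hm, hx⟩ := h1 x
      exact ⟨hm, (h ⟨T x, hm⟩).trans hx⟩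
    · exact (congrArg T (h u)).trans (h2 u)

omit [CompleteSpace H] in
theorem res_shiftP : res (shiftP A w) z = res A (z - w) := by
  have h : (fun T => IsResolvent (shiftP A w) z T) = fun T => IsResolvent A (z - w) T :=
    funext fun T => propext isResolvent_shiftP_iff
  change (if h : ∃ T, (fun T => IsResolvent (shiftP A w) z T) T then h.choose else 0) =
    if h : ∃ T, (fun T => IsResolvent A (z - w) T) T then h.choose else 0
  rw [h]

omit [CompleteSpace H] in
theorem isResolvent_res (h : z ∈ resolventSetP A) : IsResolvent A z (res A z) := by
  obtain ⟨T, hT⟩ := h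
  rwa [hT.res_eq]

theorem conj_mem_resolventSetP_adjoint (hA : Dense (A.domain : Set H))
    (h : z ∈ resolventSetP A) :
    starRingEnd ℂ z ∈ resolventSetP A.adjoint ∧
      ‖res A.adjoint (starRingEnd ℂ z)‖ = ‖res A z‖ := by
  have h1 := (isResolvent_res h).adjoint hA
  refine ⟨⟨_, h1⟩, ?_⟩
  rw [h1.res_eq]
  exact ContinuousLinearMap.adjoint.norm_map _

/-- The points `z` such that the ray `z - [0, ∞)` lies in the resolvent set of `A` and the
resolvent is `O(1 / (1 + t))` on it. -/
def rayRegularSet (A : H →ₗ.[ℂ] H) : Set ℂ :=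
  {z | ∃ C : ℝ, ∀ t : ℝ, 0 ≤ t → z - t ∈ resolventSetP A ∧ (1 + t) * ‖res A (z - t)‖ ≤ C}

theorem exists_eventually_rayRegularSet (hz : z ∈ rayRegularSet A) :
    ∃ C : ℝ, ∀ᶠ w : ℂ in 𝓝 z, ∀ t : ℝ, 0 ≤ t →
      w - (t : ℂ) ∈ resolventSetP A ∧ (1 + t) * ‖res A (w - (t : ℂ))‖ ≤ C := by
  obtain ⟨C, hC⟩ := hz
  have hC0 : 0 ≤ C := le_trans (by positivity) (hC 0 le_rfl).2
  refine ⟨2 * C, ?_⟩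
  filter_upwards [Metric.ball_mem_nhds z (by positivity : 0 < 1 / (2 * (C + 1)))] with w hw t ht
  obtain ⟨hm, hb⟩ := hC t ht
  have hwz : ‖w - z‖ < 1 / (2 * (C + 1)) := by simpa [dist_eq_norm] using hw
  have hT : ‖res A (z - t)‖ ≤ C := by
    refine le_trans ?_ hb
    nlinarith [norm_nonneg (res A (z - t))]
  have hhalf : ‖w - z‖ * ‖res A (z - t)‖ ≤ 1 / 2 := by
    calc ‖w - z‖ * ‖res A (z - t)‖ ≤ 1 / (2 * (C + 1)) * (C + 1) := by
          gcongr
          linarith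
      _ = 1 / 2 := by field_simp
  have hm' : w - t ∈ resolventSetP A := by
    refine (isResolvent_res hm).of_norm_lt_one ?_
    rw [sub_sub_sub_cancel_right, norm_smul]
    linarith
  refine ⟨hm', ?_⟩
  have hid := (isResolvent_res hm').sub_eq (isResolvent_res hm)
  rw [sub_sub_sub_cancel_right, sub_eq_iff_eq_add] at hid
  have hle : ‖res A (w - t)‖ ≤ 1 / 2 * ‖res A (w - t)‖ + ‖res A (z - t)‖ := by
    nth_rewrite 1 [hid]
    refine (norm_add_le _ _).trans ?_
    gcongr
    rw [norm_smul]
    calc ‖w - z‖ * ‖res A (w - t) * res A (z - t)‖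
        ≤ ‖w - z‖ * (‖res A (w - t)‖ * ‖res A (z - t)‖) := by gcongr; exact norm_mul_le _ _
      _ = (‖w - z‖ * ‖res A (z - t)‖) * ‖res A (w - t)‖ := by ring
      _ ≤ _ := by gcongr
  nlinarith

theorem isResolventFamily_res (A : H →ₗ.[ℂ] H) :
    IsResolventFamily (res A) (rayRegularSet A) where
  eventually_bound z hz := by
    obtain ⟨C, hC⟩ := exists_eventually_rayRegularSet hz
    exact ⟨C, hC.mono fun w hw => ⟨⟨C, hw⟩, fun t ht => (hw t ht).2⟩⟩
  sub_mem z hz s hs := by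
    obtain ⟨C, hC⟩ := hz
    refine ⟨C, fun t ht => ?_⟩
    obtain ⟨h1, h2⟩ := hC (s + t) (by positivity)
    rw [Complex.ofReal_add, ← sub_sub] at h1 h2
    refine ⟨h1, le_trans ?_ h2⟩
    gcongr
    linarith
  sub_eq z hz w hw := by
    obtain ⟨C, hC⟩ := hz
    obtain ⟨C', hC'⟩ := hw
    exact (isResolvent_res (by simpa using (hC 0 le_rfl).1)).sub_eq
      (isResolvent_res (by simpa using (hC' 0 le_rfl).1))
  regular z hz x hx := by
    obtain ⟨C, hC⟩ := hz
    have hR := isResolvent_res (by simpa using (hC 0 le_rfl).1 : z ∈ resolventSetP A)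
    ext y
    exact hR.eq_zero_of_apply_eq_zero (by simpa using congrArg (fun T : H →L[ℂ] H => T y) hx)

theorem negSqrt_eq_sqrtIntegral (A : H →ₗ.[ℂ] H) (z : ℂ) :
    negSqrt A z = sqrtIntegral (res A) z := rfl

theorem negSqrt_injective (hz : z ∈ rayRegularSet A) : Function.Injective (negSqrt A z) := by
  have h := isResolventFamily_res A
  rw [injective_iff_map_eq_zero]
  intro x hx
  have hR := isResolvent_res (A := A) (z := z) (by
    obtain ⟨C, hC⟩ := hz
    simpa using (hC 0 le_rfl).1)
  refine hR.eq_zero_of_apply_eq_zero ?_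
  rw [← h.sqrtIntegral_mul_self hz, mul_apply_eq_comp, ← negSqrt_eq_sqrtIntegral, hx,
    map_zero]

theorem conj_mem_rayRegularSet_adjoint (hA : Dense (A.domain : Set H))
    (hz : z ∈ rayRegularSet A) : starRingEnd ℂ z ∈ rayRegularSet A.adjoint := by
  obtain ⟨C, hC⟩ := hz
  refine ⟨C, fun t ht => ?_⟩
  obtain ⟨h1, h2⟩ := hC t ht
  obtain ⟨h3, h4⟩ := conj_mem_resolventSetP_adjoint hA h1
  rw [map_sub, Complex.conj_ofReal] at h3 h4
  exact ⟨h3, h4 ▸ h2⟩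

/-- If `P` is injective and its range contains that of `Q`, then `Q` factors through `P`. -/
theorem exists_comp_eq_of_range_subset {P Q : H →L[ℂ] H} (hP : Function.Injective P)
    (h : range Q ⊆ range P) : ∃ K : H →L[ℂ] H, P * K = Q := by
  choose f hf using fun x => h (mem_range_self x)
  let g : H →ₗ[ℂ] H :=
    { toFun := f
      map_add' := fun x y => hP (by simp [hf])
      map_smul' := fun c x => hP (by simp [hf]) }
  have hg : Continuous g := by
    refine g.continuous_of_seq_closed_graph fun u x y hu hgu => hP ?_
    have h1 : Tendsto (fun n => P (g (u n))) atTop (𝓝 (P y)) := (P.continuous.tendsto y).comp hgu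
    have h2 : Tendsto (fun n => Q (u n)) atTop (𝓝 (Q x)) := (Q.continuous.tendsto x).comp hu
    have h3 : (fun n => P (g (u n))) = fun n => Q (u n) := funext fun n => hf (u n)
    rw [h3] at h1
    exact (tendsto_nhds_unique h1 h2).trans (hf x).symm
  exact ⟨⟨g, hg⟩, ContinuousLinearMap.ext hf⟩

/-- An inclusion of the ranges of the inverse square roots at one point propagates, with an
analytic multiplier, to all points where both resolvents are controlled. -/
theorem exists_differentiableOn_negSqrt_mul (hw : w ∈ rayRegularSet A)
    (hw0 : w ∈ rayRegularSet A0) (hG : G ⊆ rayRegularSet A) (hG0 : G ⊆ rayRegularSet A0)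
    (h : range (negSqrt A0 w) ⊆ range (negSqrt A w)) :
    ∃ T : ℂ → H →L[ℂ] H, DifferentiableOn ℂ T G ∧
      ∀ z ∈ G, (negSqrt A z).comp (T z) = negSqrt A0 z := by
  obtain ⟨K, hK⟩ := exists_comp_eq_of_range_subset (negSqrt_injective hw) h
  obtain ⟨U, _, hU, _, hUV⟩ := (isResolventFamily_res A).exists_analytic_multipliers hw
  obtain ⟨_, V, _, hV, hUV0⟩ := (isResolventFamily_res A0).exists_analytic_multipliers hw0
  refine ⟨fun z => U z * K * V z, ((hU.mono hG).mul (differentiableOn_const K)).mul (hV.mono hG0),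
    fun z hz => ?_⟩
  change negSqrt A z * (U z * K * V z) = negSqrt A0 z
  simp only [negSqrt_eq_sqrtIntegral] at hK ⊢
  rw [← mul_assoc, ← mul_assoc, (hUV z (hG hz)).1, hK, (hUV0 z (hG0 hz)).2]

theorem mem_sectorS_iff {ω : ℝ} (h0 : 0 < ω) (hpi : ω ≤ Real.pi) :
    z ∈ sectorS ω ↔ Real.cos ω * ‖z‖ < z.re := by
  rw [sectorS, if_neg h0.ne', Set.mem_ofPred_eq]
  rcases eq_or_ne z 0 with rfl | hz
  · simp
  · have hn : 0 < ‖z‖ := norm_pos_iff.2 hz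
    rw [← lt_div_iff₀ hn, ← Complex.cos_arg hz, ← Real.cos_abs z.arg,
      Real.strictAntiOn_cos.lt_iff_gt ⟨h0.le, hpi⟩ ⟨abs_nonneg _, Complex.abs_arg_le_pi z⟩]
    simp [hz]

theorem norm_add_ofReal_le {ε : ℝ} (hε : 0 ≤ ε) : ‖z + ε‖ ≤ ‖z‖ + ε := by
  simpa [abs_of_nonneg hε] using norm_add_le z (ε : ℂ)

theorem le_norm_add_ofReal {ε : ℝ} (hε : 0 ≤ ε) : ‖z‖ - ε ≤ ‖z + ε‖ := by
  have := norm_sub_le (z + ε) (ε : ℂ)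
  rw [add_sub_cancel_right, Complex.norm_real, Real.norm_of_nonneg hε] at this
  linarith

theorem mem_closure_sectorS_of_le {ω : ℝ} (h0 : 0 ≤ ω) (hpi : ω < Real.pi)
    (hz : Real.cos ω * ‖z‖ ≤ z.re) : z ∈ closure (sectorS ω) := by
  have hlim : Tendsto (fun ε : ℝ => z + ε) (𝓝[>] 0) (𝓝 z) := by
    have : Continuous fun ε : ℝ => z + (ε : ℂ) := by fun_prop
    simpa using (this.tendsto 0).mono_left nhdsWithin_le_nhds
  refine mem_closure_of_tendsto hlim ?_
  filter_upwards [self_mem_nhdsWithin] with ε hε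
  have hε : 0 < ε := hε
  rcases h0.eq_or_lt with rfl | h0
  · rw [Real.cos_zero, one_mul] at hz
    have hre : z.re = ‖z‖ := le_antisymm (Complex.re_le_norm z) hz
    have him : z.im = 0 := by
      have := Complex.sq_norm z
      rw [Complex.normSq_apply, ← hre] at this
      nlinarith
    rw [sectorS, if_pos rfl]
    refine ⟨z.re + ε, ?_, ?_⟩
    · have := norm_nonneg z
      simp only [mem_Ioi]
      linarith
    · apply Complex.ext <;> simp [him]
  · rw [mem_sectorS_iff h0 hpi.le]
    have h1 : Real.cos ω < 1 := by
      rw [← Real.cos_zero]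
      exact Real.strictAntiOn_cos ⟨le_rfl, Real.pi_pos.le⟩ ⟨h0.le, hpi.le⟩ h0
    have h2 : -1 < Real.cos ω := by
      rw [← Real.cos_pi]
      exact Real.strictAntiOn_cos ⟨h0.le, hpi.le⟩ ⟨Real.pi_pos.le, le_rfl⟩ hpi
    have h3 := norm_add_ofReal_le (z := z) hε.le
    have h4 := le_norm_add_ofReal (z := z) hε.le
    simp only [Complex.add_re, Complex.ofReal_re]
    rcases le_total 0 (Real.cos ω) with hc | hc <;> nlinarith

theorem le_of_mem_closure_sectorS {ω : ℝ} (h0 : 0 < ω) (hpi : ω ≤ Real.pi)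
    (hz : z ∈ closure (sectorS ω)) : Real.cos ω * ‖z‖ ≤ z.re := by
  have hclosed : IsClosed {z : ℂ | Real.cos ω * ‖z‖ ≤ z.re} :=
    isClosed_le (by fun_prop) Complex.continuous_re
  exact closure_minimal (fun w hw => ((mem_sectorS_iff h0 hpi).1 hw).le) hclosed hz

theorem sub_ofReal_notMem_closure_sectorS {ω : ℝ} (h0 : 0 < ω) (hpi : ω ≤ Real.pi)
    (hz : z.re < Real.cos ω * ‖z‖) {t : ℝ} (ht : 0 ≤ t) :
    z - t ∉ closure (sectorS ω) ∧ (Real.cos ω * ‖z‖ - z.re) / 2 ≤ ‖z - t‖ := by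
  have h1 := Real.cos_le_one ω
  have h2 := Real.neg_one_le_cos ω
  have h3 : ‖z - t‖ ≤ ‖z‖ + t := by
    simpa [abs_of_nonneg ht] using norm_sub_le z (t : ℂ)
  have h4 : ‖z‖ ≤ ‖z - t‖ + t := by
    simpa [abs_of_nonneg ht] using norm_add_le (z - t) (t : ℂ)
  constructor
  · intro hmem
    have := le_of_mem_closure_sectorS h0 hpi hmem
    simp only [Complex.sub_re, Complex.ofReal_re] at this
    rcases le_total 0 (Real.cos ω) with hc | hc <;> nlinarith
  · have h5 : t - z.re ≤ ‖z - t‖ := by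
      have := (neg_le_abs _).trans (Complex.abs_re_le_norm (z - t))
      simp only [Complex.sub_re, Complex.ofReal_re] at this
      linarith
    have h6 : t ≤ ‖z - t‖ + ‖z‖ := by
      have := norm_sub_le z (z - t)
      rw [sub_sub_cancel, Complex.norm_real, Real.norm_of_nonneg ht] at this
      linarith
    rcases le_total 0 (Real.cos ω) with hc | hc <;> nlinarith

theorem mem_offSector_iff :
    z ∈ offSector t0 ω0 ↔ z + t0 ∉ closure (sectorS ω0) := by
  rw [offSector, shiftedSector, mem_compl_iff]
  have : (fun w : ℂ => -(t0 : ℂ) + w) = Homeomorph.addLeft (-(t0 : ℂ)) := rfl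
  rw [this, ← Homeomorph.image_closure]
  simp [add_comm]

theorem sectorS_subset {ω ω' : ℝ} (h0 : 0 ≤ ω) (h : ω < ω') : sectorS ω ⊆ sectorS ω' := by
  intro z hz
  rw [sectorS, if_neg (h0.trans_lt h).ne']
  rcases h0.eq_or_lt with rfl | h0
  · rw [sectorS, if_pos rfl] at hz
    obtain ⟨x, hx, rfl⟩ := hz
    have hx : 0 < x := hx
    exact ⟨Complex.ofReal_ne_zero.2 hx.ne', by simpa [Complex.arg_ofReal_of_nonneg hx.le] using h⟩
  · rw [sectorS, if_neg h0.ne'] at hz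
    exact ⟨hz.1, hz.2.trans h⟩

omit [CompleteSpace H] in
theorem sub_mem_rayRegularSet_of_shiftP (hz : z ∈ rayRegularSet (shiftP A w)) :
    z - w ∈ rayRegularSet A := by
  obtain ⟨C, hC⟩ := hz
  refine ⟨C, fun t ht => ?_⟩
  obtain ⟨⟨T, hT⟩, h2⟩ := hC t ht
  rw [res_shiftP, sub_right_comm] at h2
  rw [isResolvent_shiftP_iff, sub_right_comm] at hT
  exact ⟨⟨T, hT⟩, h2⟩

omit [CompleteSpace H] in
/-- A sectorial operator has a controlled resolvent along rays outside the sector. -/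
theorem mem_rayRegularSet_of_isSectorialP (hA : IsSectorialP A ω0) (h0 : 0 ≤ ω0)
    (hpi : ω0 < Real.pi) (hz : z.re < Real.cos ω0 * ‖z‖) : z ∈ rayRegularSet A := by
  obtain ⟨ω, hω, hωpi, hzω⟩ : ∃ ω, ω0 < ω ∧ ω < Real.pi ∧ z.re < Real.cos ω * ‖z‖ := by
    have hcont : ContinuousAt (fun ω => Real.cos ω * ‖z‖) ω0 := by fun_prop
    have h1 := (hcont.eventually (lt_mem_nhds hz)).filter_mono
      (nhdsWithin_le_nhds (s := Ioi ω0))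
    have h2 := (gt_mem_nhds hpi).filter_mono (nhdsWithin_le_nhds (s := Ioi ω0))
    obtain ⟨ω, h3, h4, h5⟩ := (h1.and (h2.and self_mem_nhdsWithin)).exists
    exact ⟨ω, h5, h4, h3⟩
  obtain ⟨M, hM⟩ := hA.2 ω hω hωpi
  set δ := (Real.cos ω * ‖z‖ - z.re) / 2 with hδ
  have hδ0 : 0 < δ := by
    rw [hδ]
    linarith
  refine ⟨(1 + ‖z‖) * (M / δ) + M, fun t ht => ?_⟩
  obtain ⟨h1, h2⟩ := sub_ofReal_notMem_closure_sectorS (h0.trans_lt hω) hωpi.le hzω ht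
  constructor
  · by_contra hmem
    exact h1 (closure_mono (sectorS_subset h0 hω) (hA.1 hmem))
  · have hb := hM _ h1
    have hn : ‖res A (z - t)‖ ≤ M / δ := by
      rw [le_div_iff₀' hδ0]
      exact le_trans (by gcongr) hb
    have ht' : t ≤ ‖z‖ + ‖z - t‖ := by
      have := norm_sub_le z (z - t)
      rwa [sub_sub_cancel, Complex.norm_real, Real.norm_of_nonneg ht] at this
    calc (1 + t) * ‖res A (z - t)‖
        ≤ (1 + ‖z‖ + ‖z - t‖) * ‖res A (z - t)‖ := by
          refine mul_le_mul_of_nonneg_right ?_ (norm_nonneg _)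
          linarith
      _ = (1 + ‖z‖) * ‖res A (z - t)‖ + ‖z - t‖ * ‖res A (z - t)‖ := by ring
      _ ≤ _ := by gcongr

theorem neg_mem_rayRegularSet_of_isPositiveTypeP {t1 : ℝ} (hA : IsPositiveTypeP (shiftP A (t0 : ℂ)))
    (h : t0 ≤ t1) : -(t1 : ℂ) ∈ rayRegularSet A := by
  have h0 : (0 : ℂ) ∈ rayRegularSet (shiftP A (t0 : ℂ)) := by
    obtain ⟨hmem, M, hM⟩ := hA
    refine ⟨M, fun t ht => ⟨?_, ?_⟩⟩
    · simpa using hmem (-t) (neg_nonpos.2 ht)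
    · simpa using hM t ht
  have h1 := (isResolventFamily_res A).sub_mem _ (sub_mem_rayRegularSet_of_shiftP h0) (t1 - t0)
    (sub_nonneg.2 h)
  convert h1 using 1
  push_cast
  ring

theorem offSector_subset_rayRegularSet (hA : IsSectorialP (shiftP A (t0 : ℂ)) ω0) (h0 : 0 ≤ ω0)
    (hpi : ω0 < Real.pi) (hdense : Dense (A.domain : Set H)) :
    offSector t0 ω0 ⊆ rayRegularSet A ∧ offSector t0 ω0 ⊆ rayRegularSet A.adjoint := by
  have key (ζ : ℂ) (hζ : ζ.re < Real.cos ω0 * ‖ζ‖) : ζ - t0 ∈ rayRegularSet A :=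
    sub_mem_rayRegularSet_of_shiftP (mem_rayRegularSet_of_isSectorialP hA h0 hpi hζ)
  have hlt {z : ℂ} (hz : z ∈ offSector t0 ω0) : (z + t0).re < Real.cos ω0 * ‖z + t0‖ :=
    not_le.1 fun h => mem_offSector_iff.1 hz (mem_closure_sectorS_of_le h0 hpi h)
  refine ⟨fun z hz => ?_, fun z hz => ?_⟩
  · simpa using key _ (hlt hz)
  · have h1 : (starRingEnd ℂ (z + t0)).re < Real.cos ω0 * ‖starRingEnd ℂ (z + t0)‖ := by
      rw [Complex.conj_re, Complex.norm_conj]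
      exact hlt hz
    simpa using conj_mem_rayRegularSet_adjoint hdense (key _ h1)

end OperatorResolvent

/-- Lemma 7.6: under Hypothesis (H)(i) together with the square-root
domain inclusions at some `t₁ ≥ t₀`, the domain inclusions hold at every
`z ∈ ℂ \ closure(-t₀ + S_{ω₀})`, and the operators `(A - z)^{1/2}(A₀ - z)^{-1/2}` and
`(A* - z)^{1/2}(A₀* - z)^{-1/2}` are bounded and analytic in operator norm there.
(`T z` is characterized by `(A - z)^{-1/2} ∘ T z = (A₀ - z)^{-1/2}`.) -/
theorem statement5
    (A A0 : H →ₗ.[ℂ] H) (t0 ω0 t1 : ℝ)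
    (hAdense : Dense (A.domain : Set H)) (hA0dense : Dense (A0.domain : Set H))
    (hAclosed : IsClosed (A.graph : Set (H × H)))
    (hA0closed : IsClosed (A0.graph : Set (H × H)))
    (hω0 : 0 ≤ ω0) (hω0' : ω0 < Real.pi)
    (hposA : IsPositiveTypeP (shiftP A (t0 : ℂ)))
    (hposA0 : IsPositiveTypeP (shiftP A0 (t0 : ℂ)))
    (hsectA : IsSectorialP (shiftP A (t0 : ℂ)) ω0)
    (hsectA0 : IsSectorialP (shiftP A0 (t0 : ℂ)) ω0)
    (ht1 : t0 ≤ t1)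
    (hdom : Set.range (negSqrt A0 (-(t1 : ℂ))) ⊆ Set.range (negSqrt A (-(t1 : ℂ))))
    (hdomStar : Set.range (negSqrt A0.adjoint (-(t1 : ℂ))) ⊆
      Set.range (negSqrt A.adjoint (-(t1 : ℂ)))) :
    (∀ z ∈ offSector t0 ω0,
      Set.range (negSqrt A0 z) ⊆ Set.range (negSqrt A z) ∧
      Set.range (negSqrt A0.adjoint z) ⊆ Set.range (negSqrt A.adjoint z)) ∧
    ∃ T Tstar : ℂ → H →L[ℂ] H,
      DifferentiableOn ℂ T (offSector t0 ω0) ∧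
      DifferentiableOn ℂ Tstar (offSector t0 ω0) ∧
      ∀ z ∈ offSector t0 ω0,
        (negSqrt A z).comp (T z) = negSqrt A0 z ∧
        (negSqrt A.adjoint z).comp (Tstar z) = negSqrt A0.adjoint z := by
  obtain ⟨hG, hGstar⟩ := offSector_subset_rayRegularSet hsectA hω0 hω0' hAdense
  obtain ⟨hG0, hG0star⟩ := offSector_subset_rayRegularSet hsectA0 hω0 hω0' hA0dense
  have hw := neg_mem_rayRegularSet_of_isPositiveTypeP hposA ht1
  have hw0 := neg_mem_rayRegularSet_of_isPositiveTypeP hposA0 ht1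
  have hwstar : -(t1 : ℂ) ∈ rayRegularSet A.adjoint := by
    simpa using conj_mem_rayRegularSet_adjoint hAdense hw
  have hw0star : -(t1 : ℂ) ∈ rayRegularSet A0.adjoint := by
    simpa using conj_mem_rayRegularSet_adjoint hA0dense hw0
  obtain ⟨T, hT, hTeq⟩ := exists_differentiableOn_negSqrt_mul hw hw0 hG hG0 hdom
  obtain ⟨Tstar, hTstar, hTstareq⟩ :=
    exists_differentiableOn_negSqrt_mul hwstar hw0star hGstar hG0star hdomStar
  refine ⟨fun z hz => ⟨?_, ?_⟩, T, Tstar, hT, hTstar, fun z hz => ⟨hTeq z hz, hTstareq z hz⟩⟩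
  · rw [← hTeq z hz]
    exact Set.range_comp_subset_range (T z) (negSqrt A z)
  · rw [← hTstareq z hz]
    exact Set.range_comp_subset_range (Tstar z) (negSqrt A.adjoint z)

end
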